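/- For δ > 0, the closed span N(1/((1+s)(s+2))) of {e^{−λs}/((1+s)(s+2)) : 0 ≤ λ ≤ δ} in H²(ℂ₊) equals the model space K_θ with θ(s) = ((1−s)/(1+s))·((2−s)/(2+s))·e^{−δs}. -/

import Mathlib

open MeasureTheory Complex Filter

noncomputable section

/-- Boundary `L²` space of the right half-plane: `L²(iℝ)` parametrized by `y ∈ ℝ`. -/
abbrev L2R := MeasureTheory.Lp ℂ 2 (volume : Measure ℝ)

/-- The Hardy space `H²(ℂ₊)` (boundary values): the closed span of the
reproducing kernels `s ↦ 1/(s + w̄)`, `Re w > 0`, evaluated at `s = iy`. -/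
def Hplus : Submodule ℂ L2R :=
  (Submodule.span ℂ {f : L2R | ∃ w : ℂ, 0 < w.re ∧
    (f : ℝ → ℂ) =ᵐ[volume] fun y : ℝ => (Complex.I * y + (starRingEnd ℂ) w)⁻¹}).topologicalClosure

/-- The model space `K_θ = H²(ℂ₊) ⊖ θ H²(ℂ₊)`, for a boundary symbol `θ`. -/
def KmodP (θ : ℝ → ℂ) : Set L2R :=
  {f | f ∈ Hplus ∧ ∀ h : L2R, h ∈ Hplus →
    ∫ y : ℝ, (starRingEnd ℂ) (θ y * h y) * f y = 0}

/-- `N(g)`: the closed span of `{g e^{-λ s} : 0 ≤ λ ≤ δ}` in `H²(ℂ₊)` (boundary model,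
`s = iy`). -/
def NspanP (δ : ℝ) (g : ℝ → ℂ) : Set L2R :=
  SetLike.coe (Submodule.span ℂ {f : L2R | ∃ lam : ℝ, 0 ≤ lam ∧ lam ≤ δ ∧
    (f : ℝ → ℂ) =ᵐ[volume]
      fun y : ℝ => g y * Complex.exp (-(lam : ℂ) * (Complex.I * y))}).topologicalClosure

/-- `N` is invariant under the adjoint multiplication semigroup `{M(t)^*}_{t ≥ 0}`:
for each `f ∈ N` and `t ≥ 0`, the projection of `e^{ts} f` onto `H²` lies in `N`. -/
def BwdInvP (N : Set L2R) : Prop :=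
  ∀ t : ℝ, 0 ≤ t → ∀ f ∈ N, ∃ n ∈ N, ∀ h : L2R, h ∈ Hplus →
    ∫ y : ℝ, (starRingEnd ℂ) (h y) *
      (Complex.exp ((t : ℂ) * (Complex.I * y)) * f y - n y) = 0


open scoped ComplexConjugate BoundedContinuousFunction InnerProductSpace

theorem re_I_mul_add (a : ℂ) (y : ℝ) : (I * y + a).re = a.re := by simp

theorem I_mul_add_ne_zero {a : ℂ} (ha : 0 < a.re) (y : ℝ) : I * y + a ≠ 0 := fun h => by
  have := congrArg Complex.re h
  rw [re_I_mul_add, Complex.zero_re] at this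
  exact ha.ne' this

/-- The function `y ↦ (iy + a)⁻¹` as a bounded continuous function, for `Re a > 0`. -/
def cauchyKernel (a : ℂ) (ha : 0 < a.re) : ℝ →ᵇ ℂ :=
  BoundedContinuousFunction.ofNormedAddCommGroup (fun y : ℝ => (I * y + a)⁻¹)
    (Continuous.inv₀ (by fun_prop) (I_mul_add_ne_zero ha)) a.re⁻¹ fun y => by
      rw [norm_inv]
      gcongr
      simpa using Complex.re_le_norm (I * y + a)

/-- The function `y ↦ e^{-t(iy)}` as a bounded continuous function. -/
def expChar (t : ℝ) : ℝ →ᵇ ℂ :=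
  BoundedContinuousFunction.ofNormedAddCommGroup
    (fun y : ℝ => Complex.exp (-(t : ℂ) * (I * y))) (by fun_prop) 1 fun y => by
      rw [Complex.norm_exp]; simp

@[simp]
theorem cauchyKernel_apply {a : ℂ} (ha : 0 < a.re) (y : ℝ) :
    cauchyKernel a ha y = (I * y + a)⁻¹ := rfl

@[simp]
theorem expChar_apply (t y : ℝ) : expChar t y = Complex.exp (-(t : ℂ) * (I * y)) := rfl

theorem norm_expChar_apply (t y : ℝ) : ‖expChar t y‖ = 1 := by
  rw [expChar_apply, Complex.norm_exp]; simp

theorem conj_expChar (t y : ℝ) : conj (expChar t y) = expChar (-t) y := by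
  rw [expChar_apply, expChar_apply, ← Complex.exp_conj]; simp

theorem expChar_add (t u y : ℝ) : expChar (t + u) y = expChar t y * expChar u y := by
  rw [expChar_apply, expChar_apply, expChar_apply, ← Complex.exp_add]
  push_cast; ring_nf

theorem memLp_bcf_mul (m : ℝ →ᵇ ℂ) {f : ℝ → ℂ} (hf : MemLp f 2) :
    MemLp (fun y => m y * f y) 2 :=
  hf.of_le_mul (c := ‖m‖) (m.continuous.aestronglyMeasurable.mul hf.1) <|
    Eventually.of_forall fun y => by
      rw [norm_mul]
      gcongr
      exact m.norm_coe_le_norm y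

/-- Multiplication by a bounded continuous function on `L²(ℝ)`. -/
def mulL (m : ℝ →ᵇ ℂ) : L2R →L[ℂ] L2R :=
  LinearMap.mkContinuous
    { toFun := fun f => (memLp_bcf_mul m (Lp.memLp f)).toLp _
      map_add' := fun f g => by
        rw [← MemLp.toLp_add]
        refine MemLp.toLp_congr _ _ ?_
        filter_upwards [Lp.coeFn_add f g] with y hy
        rw [hy, Pi.add_apply, Pi.add_apply, mul_add]
      map_smul' := fun c f => by
        rw [RingHom.id_apply, ← MemLp.toLp_const_smul]
        refine MemLp.toLp_congr _ _ ?_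
        filter_upwards [Lp.coeFn_smul c f] with y hy
        simp [hy, mul_left_comm] } ‖m‖ fun f =>
    Lp.norm_le_mul_norm_of_ae_le_mul <| by
      filter_upwards [MemLp.coeFn_toLp (memLp_bcf_mul m (Lp.memLp f))] with y hy
      simp only [LinearMap.coe_mk, AddHom.coe_mk]
      rw [hy, norm_mul]
      gcongr
      exact m.norm_coe_le_norm y

theorem coeFn_mulL (m : ℝ →ᵇ ℂ) (f : L2R) : mulL m f =ᵐ[volume] fun y => m y * f y :=
  MemLp.coeFn_toLp (memLp_bcf_mul m (Lp.memLp f))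

theorem inner_eq_integral (f g : L2R) : ⟪f, g⟫_ℂ = ∫ y : ℝ, conj (f y) * g y := by
  rw [L2.inner_def]
  simp [RCLike.inner_apply, mul_comm]

theorem integrable_conj_mul (f g : L2R) : Integrable fun y : ℝ => conj (f y) * g y := by
  have := L2.integrable_inner (𝕜 := ℂ) f g
  simpa [RCLike.inner_apply, mul_comm] using this

theorem memLp_inv_I_mul_add_one : MemLp (fun y : ℝ => (I * y + 1)⁻¹) 2 := by
  have hc : Continuous fun y : ℝ => (I * y + 1 : ℂ)⁻¹ :=
    (cauchyKernel 1 (by simp)).continuous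
  rw [memLp_two_iff_integrable_sq_norm hc.aestronglyMeasurable]
  refine integrable_inv_one_add_sq.congr (Eventually.of_forall fun y => ?_)
  simp only [norm_inv, inv_pow]
  rw [← Complex.normSq_eq_norm_sq, Complex.normSq_apply]
  simp [sq]

theorem memLp_cauchyKernel {a : ℂ} (ha : 0 < a.re) : MemLp (cauchyKernel a ha) 2 := by
  refine (memLp_bcf_mul (1 + (1 - a) • cauchyKernel a ha) memLp_inv_I_mul_add_one).ae_eq
    (Eventually.of_forall fun y => ?_)
  have h1 := I_mul_add_ne_zero ha y
  have h2 := I_mul_add_ne_zero (a := 1) (by simp) y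
  simp
  field_simp
  ring

/-- The kernel `s ↦ 1/(s + a)`, `Re a > 0`, as an element of `L²`. -/
def cauchyL2 (a : ℂ) (ha : 0 < a.re) : L2R := (memLp_cauchyKernel ha).toLp _

theorem coeFn_cauchyL2 {a : ℂ} (ha : 0 < a.re) :
    cauchyL2 a ha =ᵐ[volume] fun y : ℝ => (I * y + a)⁻¹ :=
  MemLp.coeFn_toLp (memLp_cauchyKernel ha)

theorem cauchyL2_mem_Hplus {a : ℂ} (ha : 0 < a.re) : cauchyL2 a ha ∈ Hplus :=
  Submodule.le_topologicalClosure _ <| Submodule.subset_span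
    ⟨conj a, by simpa using ha, by simpa using coeFn_cauchyL2 ha⟩

theorem isClosed_Hplus : IsClosed (Hplus : Set L2R) :=
  Submodule.isClosed_topologicalClosure _

/-- A closed subspace containing all kernels contains `Hplus`. -/
theorem Hplus_le {S : Submodule ℂ L2R} (hS : IsClosed (S : Set L2R))
    (h : ∀ (a : ℂ) (ha : 0 < a.re), cauchyL2 a ha ∈ S) : Hplus ≤ S := by
  refine Submodule.topologicalClosure_minimal _ (Submodule.span_le.2 ?_) hS
  rintro f ⟨w, hw, hf⟩
  have hwc : 0 < (conj w).re := by simpa using hw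
  have : f = cauchyL2 (conj w) hwc := Lp.ext (hf.trans (coeFn_cauchyL2 hwc).symm)
  exact this ▸ h _ hwc

/-- Closed subspaces are stable under bounded pointwise limits of multipliers. -/
theorem mulL_mem_of_tendsto {S : Submodule ℂ L2R} (hS : IsClosed (S : Set L2R))
    (m : ℕ → ℝ →ᵇ ℂ) (m' : ℝ →ᵇ ℂ) (C : ℝ) (hC : ∀ n y, ‖m n y‖ ≤ C)
    (hm : ∀ y, Tendsto (fun n => m n y) atTop (nhds (m' y))) (f : L2R)
    (hmem : ∀ᶠ n in atTop, mulL (m n) f ∈ S) : mulL m' f ∈ S := by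
  have : CompleteSpace S := hS.completeSpace_coe
  rw [← S.orthogonal_orthogonal, Submodule.mem_orthogonal]
  intro v hv
  have key : ∀ k : ℝ →ᵇ ℂ, ⟪v, mulL k f⟫_ℂ = ∫ y, k y * (conj (v y) * f y) := fun k => by
    rw [inner_eq_integral]
    refine integral_congr_ae ?_
    filter_upwards [coeFn_mulL k f] with y hy
    rw [hy]; ring
  have hlim : Tendsto (fun n => ⟪v, mulL (m n) f⟫_ℂ) atTop (nhds ⟪v, mulL m' f⟫_ℂ) := by
    simp_rw [key]
    refine tendsto_integral_of_dominated_convergence (fun y => C * ‖conj (v y) * f y‖)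
      (fun n => (m n).continuous.aestronglyMeasurable.mul (integrable_conj_mul v f).1)
      ((integrable_conj_mul v f).norm.const_mul C) (fun n => Eventually.of_forall fun y => ?_)
      (Eventually.of_forall fun y => (hm y).mul_const _)
    rw [norm_mul]
    gcongr
    exact hC n y
  refine tendsto_nhds_unique hlim (tendsto_const_nhds.congr' ?_)
  filter_upwards [hmem] with n hn
  exact ((Submodule.mem_orthogonal' _ _).1 hv _ hn).symm

theorem mulL_mul (m k : ℝ →ᵇ ℂ) (f : L2R) : mulL (m * k) f = mulL m (mulL k f) := by
  refine Lp.ext ?_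
  filter_upwards [coeFn_mulL (m * k) f, coeFn_mulL m (mulL k f), coeFn_mulL k f] with y h1 h2 h3
  rw [h1, h2, h3, BoundedContinuousFunction.mul_apply, mul_assoc]

theorem mulL_mem_Hplus {m : ℝ →ᵇ ℂ}
    (h : ∀ (a : ℂ) (ha : 0 < a.re), mulL m (cauchyL2 a ha) ∈ Hplus) {f : L2R}
    (hf : f ∈ Hplus) : mulL m f ∈ Hplus :=
  Hplus_le (S := Hplus.comap (mulL m).toLinearMap)
    (isClosed_Hplus.preimage (mulL m).continuous) h hf

theorem mulL_cauchyKernel_cauchyL2 {a b : ℂ} (ha : 0 < a.re) (hb : 0 < b.re) (hab : a ≠ b) :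
    mulL (cauchyKernel b hb) (cauchyL2 a ha) =
      (a - b)⁻¹ • (cauchyL2 b hb - cauchyL2 a ha) := by
  refine Lp.ext ?_
  filter_upwards [coeFn_mulL (cauchyKernel b hb) (cauchyL2 a ha), coeFn_cauchyL2 ha,
    coeFn_cauchyL2 hb, Lp.coeFn_sub (cauchyL2 b hb) (cauchyL2 a ha),
    Lp.coeFn_smul (a - b)⁻¹ (cauchyL2 b hb - cauchyL2 a ha)] with y h1 h2 h3 h4 h5
  rw [h1, h5, Pi.smul_apply, h4, Pi.sub_apply, h2, h3, cauchyKernel_apply, smul_eq_mul]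
  have := sub_ne_zero.2 hab
  have := I_mul_add_ne_zero ha y
  have := I_mul_add_ne_zero hb y
  field_simp
  ring

theorem cauchyKernel_mem_Hplus {b : ℂ} (hb : 0 < b.re) {f : L2R} (hf : f ∈ Hplus) :
    mulL (cauchyKernel b hb) f ∈ Hplus := by
  refine mulL_mem_Hplus (fun a ha => ?_) hf
  by_cases hab : a = b
  · subst hab
    have hre : ∀ n : ℕ, a.re < (a + 1 / ((n : ℂ) + 1)).re := fun n => by
      have : (1 / ((n : ℂ) + 1)) = ((1 / ((n : ℝ) + 1) : ℝ) : ℂ) := by push_cast; rfl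
      rw [this, Complex.add_re, Complex.ofReal_re]
      linarith [Nat.one_div_pos_of_nat (α := ℝ) (n := n)]
    refine mulL_mem_of_tendsto isClosed_Hplus
      (fun n => cauchyKernel (a + 1 / ((n : ℂ) + 1)) (ha.trans (hre n))) _ a.re⁻¹
      (fun n y => ?_) (fun y => ?_) _ (Eventually.of_forall fun n => ?_)
    · rw [cauchyKernel_apply, norm_inv]
      gcongr
      exact ((hre n).le.trans_eq (re_I_mul_add _ y).symm).trans (Complex.re_le_norm _)
    · simp only [cauchyKernel_apply]
      refine Tendsto.inv₀ ?_ (I_mul_add_ne_zero ha y)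
      have := (tendsto_one_div_add_atTop_nhds_zero_nat (𝕜 := ℂ)).const_add (I * y + a)
      simpa [add_assoc] using this
    · rw [mulL_cauchyKernel_cauchyL2 ha _ (fun h => (hre n).ne (congrArg Complex.re h))]
      exact Hplus.smul_mem _ (Hplus.sub_mem (cauchyL2_mem_Hplus _) (cauchyL2_mem_Hplus _))
  · rw [mulL_cauchyKernel_cauchyL2 ha hb hab]
    exact Hplus.smul_mem _ (Hplus.sub_mem (cauchyL2_mem_Hplus _) (cauchyL2_mem_Hplus _))

theorem mulL_smul (c : ℂ) (m : ℝ →ᵇ ℂ) (f : L2R) : mulL (c • m) f = c • mulL m f := by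
  refine Lp.ext ?_
  filter_upwards [coeFn_mulL (c • m) f, coeFn_mulL m f, Lp.coeFn_smul c (mulL m f)]
    with y h1 h2 h3
  rw [h1, h3, Pi.smul_apply, h2, BoundedContinuousFunction.smul_apply, smul_mul_assoc]

theorem mulL_one (f : L2R) : mulL 1 f = f := by
  refine Lp.ext ?_
  filter_upwards [coeFn_mulL 1 f] with y h1
  rw [h1, BoundedContinuousFunction.coe_one, Pi.one_apply, one_mul]

theorem mulL_pow_mem_Hplus {m : ℝ →ᵇ ℂ} (h : ∀ f ∈ Hplus, mulL m f ∈ Hplus) (n : ℕ) :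
    ∀ f ∈ Hplus, mulL (m ^ n) f ∈ Hplus := by
  induction n with
  | zero => intro f hf; rwa [pow_zero, mulL_one]
  | succ n ih => intro f hf; rw [pow_succ, mulL_mul]; exact ih _ (h f hf)

/-- `Hplus` is invariant under multiplication by `e^{-ts}`, `t ≥ 0`. -/
theorem expChar_mem_Hplus {t : ℝ} (ht : 0 ≤ t) {f : L2R} (hf : f ∈ Hplus) :
    mulL (expChar t) f ∈ Hplus := by
  rcases ht.eq_or_lt with rfl | ht
  · have : expChar 0 = 1 := by ext y; simp
    rwa [this, mulL_one]
  have hre : ∀ n : ℕ, 0 < ((((n : ℝ) + 1) / t : ℝ) : ℂ).re := fun n => by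
    rw [Complex.ofReal_re]; positivity
  have hval : ∀ (n : ℕ) (y : ℝ), ((((((n : ℝ) + 1) / t : ℝ) : ℂ) •
      cauchyKernel _ (hre n)) ^ (n + 1)) y =
        ((1 + (t * (I * y)) / ((n + 1 : ℕ) : ℂ)) ^ (n + 1))⁻¹ := fun n y => by
    rw [BoundedContinuousFunction.pow_apply, BoundedContinuousFunction.smul_apply,
      cauchyKernel_apply, ← inv_pow, smul_eq_mul]
    congr 1
    have h0 := I_mul_add_ne_zero (hre n) y
    have h1 : (t : ℂ) ≠ 0 := by exact_mod_cast ht.ne'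
    have h2 : ((n : ℂ) + 1) ≠ 0 := by exact_mod_cast n.succ_ne_zero
    have h3 : (n : ℂ) + 1 + t * I * y ≠ 0 := by
      intro h; apply h0; push_cast; field_simp; linear_combination h
    push_cast at h0 ⊢
    rw [eq_comm, inv_eq_iff_eq_inv, mul_inv, inv_inv]
    field_simp
    ring
  refine mulL_mem_of_tendsto isClosed_Hplus
    (fun n : ℕ => (((((n : ℝ) + 1) / t : ℝ) : ℂ) • cauchyKernel _ (hre n)) ^ (n + 1)) _ 1
    (fun n y => ?_) (fun y => ?_) f (Eventually.of_forall fun n => ?_)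
  · rw [hval, norm_inv, norm_pow]
    refine inv_le_one_of_one_le₀ (one_le_pow₀ ?_)
    have h : (1 + (t * (I * y)) / ((n + 1 : ℕ) : ℂ)).re = 1 := by
      rw [Complex.add_re, Complex.one_re, Complex.div_natCast_re]
      simp
    exact h.symm.le.trans (Complex.re_le_norm _)
  · simp_rw [hval]
    have h := (Complex.tendsto_one_add_div_pow_exp (t * (I * y))).comp (tendsto_add_atTop_nat 1)
    have h' := h.inv₀ (Complex.exp_ne_zero _)
    rw [← Complex.exp_neg, ← neg_mul] at h'
    exact h'
  · refine mulL_pow_mem_Hplus (fun f hf => ?_) _ f hf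
    rw [mulL_smul]
    exact Hplus.smul_mem _ (cauchyKernel_mem_Hplus _ hf)

theorem tendsto_inv_I_mul_add (a : ℂ) {l : Filter ℝ} (hl : Tendsto (fun y : ℝ => |y|) l atTop) :
    Tendsto (fun y : ℝ => (I * y + a)⁻¹) l (nhds 0) := by
  refine tendsto_inv₀_cobounded.comp (tendsto_norm_atTop_iff_cobounded.1 ?_)
  refine tendsto_atTop_mono (fun y => ?_) (tendsto_atTop_add_const_right l (-‖a‖) hl)
  have := norm_sub_le (I * y + a) a
  rw [add_sub_cancel_right, norm_mul, Complex.norm_I, one_mul, Complex.norm_real,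
    Real.norm_eq_abs] at this
  linarith

theorem integrable_cauchy_mul_cauchy {a b : ℂ} (ha : 0 < a.re) (hb : 0 < b.re) :
    Integrable fun y : ℝ => (I * y + a)⁻¹ * (I * y + b)⁻¹ :=
  (memLp_cauchyKernel ha).integrable_mul (memLp_cauchyKernel hb)

theorem hasDerivAt_I_mul_add (a : ℂ) (y : ℝ) : HasDerivAt (fun y : ℝ => I * y + a) I y := by
  simpa using ((Complex.ofRealCLM.hasDerivAt (x := y)).const_mul I).add_const a

theorem div_mem_slitPlane_of_re_pos {z w : ℂ} (hz : 0 < z.re) (hw : 0 < w.re) :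
    z / w ∈ Complex.slitPlane := by
  rw [Complex.mem_slitPlane_iff_not_le_zero]
  intro h
  have hw0 : w ≠ 0 := fun h => by simp [h] at hw
  have him : (z / w).im = 0 := (Complex.le_def.1 h).2
  have hre : (z / w).re ≤ 0 := (Complex.le_def.1 h).1
  have h1 : z = z / w * w := (div_mul_cancel₀ z hw0).symm
  have h2 := congrArg Complex.re h1
  rw [Complex.mul_re, him] at h2
  nlinarith

theorem integral_cauchy_mul_cauchy {a b : ℂ} (ha : 0 < a.re) (hb : 0 < b.re) :
    ∫ y : ℝ, (I * y + a)⁻¹ * (I * y + b)⁻¹ = 0 := by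
  have hint := integrable_cauchy_mul_cauchy ha hb
  by_cases hab : a = b
  · subst hab
    have hlim : ∀ l : Filter ℝ, Tendsto (fun y : ℝ => |y|) l atTop →
        Tendsto (fun y : ℝ => I * (I * y + a)⁻¹) l (nhds 0) := fun l hl => by
      simpa using (tendsto_inv_I_mul_add a hl).const_mul I
    have := integral_of_hasDerivAt_of_tendsto
      (f := fun y : ℝ => I * (I * y + a)⁻¹) (fun y => ?_) hint
      (hlim _ tendsto_abs_atBot_atTop) (hlim _ tendsto_abs_atTop_atTop)
    · simpa using this
    · have h0 := I_mul_add_ne_zero ha y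
      convert! ((hasDerivAt_I_mul_add a y).inv h0).const_mul I using 1
      field_simp
      simp
  · have hba : b - a ≠ 0 := sub_ne_zero.2 (Ne.symm hab)
    have hlim : ∀ l : Filter ℝ, Tendsto (fun y : ℝ => |y|) l atTop →
        Tendsto (fun y : ℝ => (I * (b - a))⁻¹ * Complex.log ((I * y + a) / (I * y + b))) l
          (nhds 0) := fun l hl => by
      have h1 : Tendsto (fun y : ℝ => (I * y + a) / (I * y + b)) l (nhds 1) := by
        have := ((tendsto_inv_I_mul_add b hl).const_mul (a - b)).const_add 1
        rw [mul_zero, add_zero] at this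
        refine this.congr fun y => ?_
        have := I_mul_add_ne_zero hb y
        field_simp
        ring
      simpa using (h1.clog (by simp)).const_mul (I * (b - a))⁻¹
    have := integral_of_hasDerivAt_of_tendsto
      (f := fun y : ℝ => (I * (b - a))⁻¹ * Complex.log ((I * y + a) / (I * y + b)))
      (fun y => ?_) hint (hlim _ tendsto_abs_atBot_atTop) (hlim _ tendsto_abs_atTop_atTop)
    · simpa using this
    · have h0 := I_mul_add_ne_zero ha y
      have h1 := I_mul_add_ne_zero hb y
      have hs : (I * y + a) / (I * y + b) ∈ Complex.slitPlane :=
        div_mem_slitPlane_of_re_pos (by simpa using ha) (by simpa using hb)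
      convert! ((((hasDerivAt_I_mul_add a y).fun_div
        (hasDerivAt_I_mul_add b y) h1).clog_real hs).const_mul (I * (b - a))⁻¹) using 1
      have := Complex.I_ne_zero
      field_simp
      ring

/-- Functions of `Hplus` have zero bilinear pairing with the kernels. -/
theorem integral_mul_cauchy_of_mem_Hplus {b : ℂ} (hb : 0 < b.re) {h : L2R} (hh : h ∈ Hplus) :
    ∫ y : ℝ, h y * (I * y + b)⁻¹ = 0 := by
  have hv := (memLp_cauchyKernel hb).star
  have key : ∀ f : L2R, ⟪hv.toLp, f⟫_ℂ = ∫ y : ℝ, f y * (I * y + b)⁻¹ := fun f => by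
    rw [inner_eq_integral]
    refine integral_congr_ae ?_
    filter_upwards [hv.coeFn_toLp] with y hy
    rw [hy, Pi.star_apply, ← starRingEnd_apply, Complex.conj_conj, mul_comm, cauchyKernel_apply]
  have hle : Hplus ≤ (ℂ ∙ hv.toLp)ᗮ := by
    refine Hplus_le (Submodule.isClosed_orthogonal _) fun a ha => ?_
    rw [Submodule.mem_orthogonal_singleton_iff_inner_right, key,
      ← integral_cauchy_mul_cauchy ha hb]
    refine integral_congr_ae ?_
    filter_upwards [coeFn_cauchyL2 ha] with y hy
    rw [hy]
  rw [← key]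
  exact Submodule.mem_orthogonal_singleton_iff_inner_right.1 (hle hh)

theorem one_re_pos : 0 < (1 : ℂ).re := by simp

theorem two_re_pos : 0 < (2 : ℂ).re := by simp

/-- The function `1/((1+s)(s+2))` as an element of `L²`. -/
def genL2 : L2R := cauchyL2 1 one_re_pos - cauchyL2 2 two_re_pos

theorem coeFn_genL2 : genL2 =ᵐ[volume] fun y : ℝ => ((1 + I * y) * (I * y + 2))⁻¹ := by
  filter_upwards [Lp.coeFn_sub (cauchyL2 1 one_re_pos) (cauchyL2 2 two_re_pos),
    coeFn_cauchyL2 one_re_pos, coeFn_cauchyL2 two_re_pos] with y h1 h2 h3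
  rw [genL2, h1, Pi.sub_apply, h2, h3, add_comm 1 (I * (y : ℂ))]
  have := I_mul_add_ne_zero one_re_pos y
  have := I_mul_add_ne_zero two_re_pos y
  field_simp
  ring

theorem genL2_mem_Hplus : genL2 ∈ Hplus :=
  Hplus.sub_mem (cauchyL2_mem_Hplus _) (cauchyL2_mem_Hplus _)

/-- The inner function `((1-s)/(1+s))((2-s)/(2+s))e^{-δs}` on the boundary. -/
def thetaBCF (δ : ℝ) : ℝ →ᵇ ℂ :=
  ((2 : ℂ) • cauchyKernel 1 one_re_pos - 1) * ((4 : ℂ) • cauchyKernel 2 two_re_pos - 1) *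
    expChar δ

theorem thetaBCF_apply (δ y : ℝ) : thetaBCF δ y = (1 - I * y) / (1 + I * y) *
    ((2 - I * y) / (2 + I * y)) * expChar δ y := by
  have h1 := I_mul_add_ne_zero one_re_pos y
  have h2 := I_mul_add_ne_zero two_re_pos y
  simp only [thetaBCF, BoundedContinuousFunction.mul_apply, BoundedContinuousFunction.sub_apply,
    BoundedContinuousFunction.smul_apply, BoundedContinuousFunction.coe_one, Pi.one_apply,
    cauchyKernel_apply, smul_eq_mul, add_comm (1 : ℂ), add_comm (2 : ℂ)]
  congr 1
  field_simp
  ring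

/-- The model space as a submodule. -/
def modelSpace (δ : ℝ) : Submodule ℂ L2R :=
  Hplus ⊓ (Hplus.map (mulL (thetaBCF δ)).toLinearMap)ᗮ

theorem mem_modelSpace {δ : ℝ} {f : L2R} :
    f ∈ modelSpace δ ↔ f ∈ Hplus ∧ ∀ h ∈ Hplus, ⟪mulL (thetaBCF δ) h, f⟫_ℂ = 0 := by
  rw [modelSpace, Submodule.mem_inf, Submodule.mem_orthogonal]
  refine and_congr_right fun _ => ⟨fun H h hh => H _ ⟨h, hh, rfl⟩, ?_⟩
  rintro H _ ⟨h, hh, rfl⟩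
  exact H h hh

theorem isClosed_modelSpace (δ : ℝ) : IsClosed (modelSpace δ : Set L2R) :=
  isClosed_Hplus.inter (Submodule.isClosed_orthogonal _)

theorem KmodP_eq_modelSpace (δ : ℝ) :
    KmodP (fun y : ℝ => (1 - Complex.I * y) / (1 + Complex.I * y) *
          ((2 - Complex.I * y) / (2 + Complex.I * y)) *
          Complex.exp (-(δ : ℂ) * (Complex.I * y))) = modelSpace δ := by
  ext f
  rw [SetLike.mem_coe, mem_modelSpace]
  refine and_congr_right fun _ => forall₂_congr fun h _ => ?_
  rw [inner_eq_integral]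
  refine Eq.congr_left (integral_congr_ae ?_)
  filter_upwards [coeFn_mulL (thetaBCF δ) h] with y hy
  rw [hy, thetaBCF_apply, expChar_apply]

/-- The closed span of `{e^{-λs}/((1+s)(s+2)) : 0 ≤ λ ≤ δ}` as a submodule. -/
def genSpan (δ : ℝ) : Submodule ℂ L2R :=
  (Submodule.span ℂ ((fun t => mulL (expChar t) genL2) '' Set.Icc 0 δ)).topologicalClosure

theorem mulL_genL2_mem_genSpan {δ t : ℝ} (ht : t ∈ Set.Icc 0 δ) :
    mulL (expChar t) genL2 ∈ genSpan δ :=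
  Submodule.le_topologicalClosure _ (Submodule.subset_span ⟨t, ht, rfl⟩)

theorem NspanP_eq_genSpan (δ : ℝ) :
    NspanP δ (fun y : ℝ => ((1 + Complex.I * y) * (Complex.I * y + 2))⁻¹) = genSpan δ := by
  have hval : ∀ t : ℝ, mulL (expChar t) genL2 =ᵐ[volume] fun y : ℝ =>
      ((1 + Complex.I * y) * (Complex.I * y + 2))⁻¹ *
        Complex.exp (-(t : ℂ) * (Complex.I * y)) := fun t => by
    filter_upwards [coeFn_mulL (expChar t) genL2, coeFn_genL2] with y h1 h2
    rw [h1, h2, mul_comm, expChar_apply]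
  rw [NspanP, genSpan]
  congr 3
  ext f
  constructor
  · rintro ⟨t, h0, hδ, hf⟩
    exact ⟨t, ⟨h0, hδ⟩, Lp.ext ((hval t).trans hf.symm)⟩
  · rintro ⟨t, ⟨h0, hδ⟩, rfl⟩
    exact ⟨t, h0, hδ, hval t⟩

theorem genSpan_le_modelSpace (δ : ℝ) : genSpan δ ≤ modelSpace δ := by
  refine Submodule.topologicalClosure_minimal _ (Submodule.span_le.2 ?_) (isClosed_modelSpace δ)
  rintro _ ⟨t, ⟨h0, hδ⟩, rfl⟩
  refine mem_modelSpace.2 ⟨expChar_mem_Hplus h0 genL2_mem_Hplus, fun h hh => ?_⟩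
  have hu := expChar_mem_Hplus (sub_nonneg.2 hδ) hh
  set u := mulL (expChar (δ - t)) h with hu_def
  have hint : ∀ (b : ℂ) (hb : 0 < b.re), Integrable fun y : ℝ => u y * (I * y + b)⁻¹ :=
    fun b hb => (Lp.memLp u).integrable_mul (memLp_cauchyKernel hb)
  have hzero : ∫ y : ℝ, (u y * (I * y + 1)⁻¹ - u y * (I * y + 2)⁻¹) = 0 := by
    rw [integral_sub (hint 1 one_re_pos) (hint 2 two_re_pos),
      integral_mul_cauchy_of_mem_Hplus one_re_pos hu,
      integral_mul_cauchy_of_mem_Hplus two_re_pos hu, sub_zero]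
  rw [inner_eq_integral, ← map_zero conj, ← hzero, ← integral_conj]
  refine integral_congr_ae ?_
  filter_upwards [coeFn_mulL (thetaBCF δ) h, coeFn_mulL (expChar t) genL2, coeFn_genL2,
    coeFn_mulL (expChar (δ - t)) h] with y h1 h2 h3 h4
  have e1 := I_mul_add_ne_zero one_re_pos y
  have e2 := I_mul_add_ne_zero two_re_pos y
  have e1' : (1 : ℂ) - I * y ≠ 0 := fun h => by simpa using congrArg Complex.re h
  have e2' : (2 : ℂ) - I * y ≠ 0 := fun h => by simpa using congrArg Complex.re h
  rw [h1, h2, h3, hu_def, h4, thetaBCF_apply, sub_eq_add_neg δ t, expChar_add]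
  simp only [map_mul, map_sub, map_div₀, map_inv₀, map_add, Complex.conj_I, Complex.conj_ofReal,
    map_one, Complex.conj_ofNat, conj_expChar, neg_neg, neg_mul, sub_neg_eq_add,
    add_comm (1 : ℂ), add_comm (2 : ℂ), neg_add_eq_sub]
  field_simp
  ring

theorem inner_mulL_expChar (t : ℝ) (v r : L2R) :
    ⟪mulL (expChar t) v, r⟫_ℂ = ∫ y : ℝ, expChar (-t) y * (conj (v y) * r y) := by
  rw [inner_eq_integral]
  refine integral_congr_ae ?_
  filter_upwards [coeFn_mulL (expChar t) v] with y hy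
  rw [hy, map_mul, conj_expChar, mul_assoc]

theorem hasDerivAt_inner_mulL_expChar {v w : L2R}
    (hw : w =ᵐ[volume] fun y : ℝ => I * y * v y) (r : L2R) (t : ℝ) :
    HasDerivAt (fun t => ⟪mulL (expChar t) v, r⟫_ℂ) (-⟪mulL (expChar t) w, r⟫_ℂ) t := by
  simp_rw [inner_mulL_expChar]
  rw [← integral_neg]
  have hm : ∀ t, AEStronglyMeasurable (expChar t : ℝ → ℂ) volume :=
    fun t => (expChar t).continuous.aestronglyMeasurable
  refine (hasDerivAt_integral_of_dominated_loc_of_deriv_le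
    (F := fun t y => expChar (-t) y * (conj (v y) * r y))
    (F' := fun t y => -(expChar (-t) y * (conj (w y) * r y)))
    (bound := fun y => ‖conj (w y) * r y‖) (s := Set.univ) Filter.univ_mem
    (Eventually.of_forall fun u => (hm _).mul (integrable_conj_mul v r).1)
    ((integrable_conj_mul v r).bdd_mul (c := 1) (hm _)
      (Eventually.of_forall fun y => (norm_expChar_apply _ y).le))
    ((hm _).mul (integrable_conj_mul w r).1).neg
    (Eventually.of_forall fun y u _ => ?_) (integrable_conj_mul w r).norm ?_).2
  · rw [norm_neg, norm_mul, norm_expChar_apply, one_mul]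
  · filter_upwards [hw] with y hy u _
    have h1 : HasDerivAt (fun u : ℝ => (u : ℂ) * (I * y)) (I * y) u := by
      simpa using (Complex.ofRealCLM.hasDerivAt (x := u)).mul_const (I * (y : ℂ))
    have h2 := h1.cexp.mul_const (conj (v y) * r y)
    simp only [expChar_apply, Complex.ofReal_neg, neg_neg]
    convert! h2 using 1
    rw [hy]
    simp only [map_mul, Complex.conj_I, Complex.conj_ofReal]
    ring

theorem inner_expChar_cauchyL2_eq_zero {δ : ℝ} (hδ : 0 < δ) {r : L2R}
    (hr : ∀ t ∈ Set.Icc 0 δ, ⟪mulL (expChar t) genL2, r⟫_ℂ = 0) {t : ℝ} (ht : t ∈ Set.Icc 0 δ) :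
    ⟪mulL (expChar t) (cauchyL2 1 one_re_pos), r⟫_ℂ = 0 ∧
      ⟪mulL (expChar t) (cauchyL2 2 two_re_pos), r⟫_ℂ = 0 := by
  set w : L2R := (2 : ℂ) • cauchyL2 2 two_re_pos - cauchyL2 1 one_re_pos with hw_def
  have hw : w =ᵐ[volume] fun y : ℝ => I * y * genL2 y := by
    filter_upwards [Lp.coeFn_sub ((2 : ℂ) • cauchyL2 2 two_re_pos) (cauchyL2 1 one_re_pos),
      Lp.coeFn_smul (2 : ℂ) (cauchyL2 2 two_re_pos), coeFn_cauchyL2 one_re_pos,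
      coeFn_cauchyL2 two_re_pos, coeFn_genL2] with y h1 h2 h3 h4 h5
    rw [hw_def, h1, Pi.sub_apply, h2, Pi.smul_apply, h3, h4, h5, smul_eq_mul,
      add_comm 1 (I * (y : ℂ))]
    have := I_mul_add_ne_zero one_re_pos y
    have := I_mul_add_ne_zero two_re_pos y
    field_simp
    ring
  have hw0 : ⟪mulL (expChar t) w, r⟫_ℂ = 0 := by
    have h1 := (hasDerivAt_inner_mulL_expChar hw r t).hasDerivWithinAt (s := Set.Icc 0 δ)
    have h2 := (hasDerivWithinAt_const t (Set.Icc 0 δ) (0 : ℂ)).congr hr (hr t ht)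
    exact neg_eq_zero.1 (((uniqueDiffOn_Icc hδ) t ht).eq_deriv _ h1 h2)
  have e1 : cauchyL2 1 one_re_pos = w + (2 : ℂ) • genL2 := by
    rw [hw_def, genL2]; module
  have e2 : cauchyL2 2 two_re_pos = w + genL2 := by
    rw [hw_def, genL2]; module
  rw [e1, e2, map_add, map_add, map_smul, inner_add_left, inner_add_left, inner_smul_left,
    hw0, hr t ht]
  simp

theorem integral_Ioi_exp_mul_integral {u : ℝ → ℂ} (hu : Integrable u) {c : ℂ} (hc : 0 < c.re)
    (t : ℝ) :
    ∫ x in Set.Ioi t, Complex.exp (-c * x) * ∫ y : ℝ, expChar (-x) y * u y =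
      ∫ y : ℝ, Complex.exp (-c * t) * (expChar (-t) y * ((c - I * y)⁻¹ * u y)) := by
  have hint : Integrable (Function.uncurry fun x y : ℝ =>
      Complex.exp (-c * x) * (expChar (-x) y * u y))
        ((volume.restrict (Set.Ioi t)).prod volume) := by
    have h1 : IntegrableOn (fun x : ℝ => Complex.exp (-c * x)) (Set.Ioi t) :=
      integrableOn_exp_mul_complex_Ioi (by simpa using hc) t
    have h2 := (Integrable.mul_prod h1 hu).bdd_mul (c := 1)
      (f := fun p : ℝ × ℝ => expChar (-p.1) p.2)
      (Continuous.aestronglyMeasurable (by simp only [expChar_apply]; fun_prop))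
      (Eventually.of_forall fun p => (norm_expChar_apply _ _).le)
    refine h2.congr (Eventually.of_forall fun p => ?_)
    simp only [Function.uncurry]
    ring
  simp_rw [← integral_const_mul]
  rw [integral_integral_swap hint]
  refine integral_congr_ae (Eventually.of_forall fun y => ?_)
  have hre : (-(c - I * y)).re < 0 := by simpa using hc
  have hne : c - I * y ≠ 0 := fun h => by rw [h] at hre; simp at hre
  have h1 : ∀ x : ℝ, Complex.exp (-c * x) * (expChar (-x) y * u y) =
      Complex.exp (-(c - I * y) * x) * u y := fun x => by
    rw [expChar_apply, ← mul_assoc, ← Complex.exp_add]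
    push_cast; ring_nf
  have h2 := h1 t
  simp only [h1]
  rw [integral_mul_const, integral_exp_mul_complex_Ioi hre, neg_div_neg_eq]
  linear_combination (-(c - I * y)⁻¹) * h2

theorem mulL_mul_cauchyKernel_cauchyL2 (m : ℝ →ᵇ ℂ) {a b : ℂ} (ha : 0 < a.re) (hb : 0 < b.re)
    (hab : a ≠ b) : mulL (m * cauchyKernel b hb) (cauchyL2 a ha) =
      (a - b)⁻¹ • (mulL m (cauchyL2 b hb) - mulL m (cauchyL2 a ha)) := by
  rw [mulL_mul, mulL_cauchyKernel_cauchyL2 ha hb hab, map_smul, map_sub]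

theorem eq_zero_of_mem_modelSpace {δ : ℝ} (hδ : 0 < δ) {r : L2R} (hr : r ∈ modelSpace δ)
    (hr' : ∀ t ∈ Set.Icc 0 δ, ⟪mulL (expChar t) genL2, r⟫_ℂ = 0) : r = 0 := by
  obtain ⟨hrH, hrθ⟩ := mem_modelSpace.1 hr
  have hE := fun t ht => inner_expChar_cauchyL2_eq_zero hδ hr' (t := t) ht
  have hδmem : δ ∈ Set.Icc 0 δ := ⟨hδ.le, le_rfl⟩
  have h0mem : (0 : ℝ) ∈ Set.Icc 0 δ := ⟨le_rfl, hδ.le⟩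
  have hexp0 : expChar 0 = 1 := by ext y; simp
  have hk1 : ⟪cauchyL2 1 one_re_pos, r⟫_ℂ = 0 := by
    simpa [hexp0, mulL_one] using (hE 0 h0mem).1
  have hδk : ∀ (a : ℂ) (ha : 0 < a.re), ⟪mulL (expChar δ) (cauchyL2 a ha), r⟫_ℂ = 0 := by
    intro a ha
    have hdecomp : ((1 + a) * (2 + a)) • mulL (expChar δ) (cauchyL2 a ha) =
        (6 * (2 - a)) • mulL (expChar δ) (cauchyL2 1 one_re_pos) +
        (12 * (a - 1)) • mulL (expChar δ) (cauchyL2 2 two_re_pos) +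
        ((1 - a) * (2 - a)) • mulL (thetaBCF δ) (cauchyL2 a ha) := by
      refine Lp.ext ?_
      filter_upwards [
        Lp.coeFn_smul ((1 + a) * (2 + a)) (mulL (expChar δ) (cauchyL2 a ha)),
        Lp.coeFn_add ((6 * (2 - a)) • mulL (expChar δ) (cauchyL2 1 one_re_pos) +
          (12 * (a - 1)) • mulL (expChar δ) (cauchyL2 2 two_re_pos))
          (((1 - a) * (2 - a)) • mulL (thetaBCF δ) (cauchyL2 a ha)),
        Lp.coeFn_add ((6 * (2 - a)) • mulL (expChar δ) (cauchyL2 1 one_re_pos))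
          ((12 * (a - 1)) • mulL (expChar δ) (cauchyL2 2 two_re_pos)),
        Lp.coeFn_smul (6 * (2 - a)) (mulL (expChar δ) (cauchyL2 1 one_re_pos)),
        Lp.coeFn_smul (12 * (a - 1)) (mulL (expChar δ) (cauchyL2 2 two_re_pos)),
        Lp.coeFn_smul ((1 - a) * (2 - a)) (mulL (thetaBCF δ) (cauchyL2 a ha)),
        coeFn_mulL (expChar δ) (cauchyL2 a ha),
        coeFn_mulL (expChar δ) (cauchyL2 1 one_re_pos),
        coeFn_mulL (expChar δ) (cauchyL2 2 two_re_pos),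
        coeFn_mulL (thetaBCF δ) (cauchyL2 a ha),
        coeFn_cauchyL2 ha, coeFn_cauchyL2 one_re_pos, coeFn_cauchyL2 two_re_pos]
        with y h1 h2 h3 h4 h5 h6 h7 h8 h9 h10 h11 h12 h13
      rw [h1, h2, Pi.add_apply, h3, Pi.add_apply, h4, h5, h6]
      simp only [Pi.smul_apply, smul_eq_mul]
      rw [h7, h8, h9, h10, h11, h12, h13, thetaBCF_apply, add_comm (1 : ℂ) (I * y),
        add_comm (2 : ℂ) (I * y)]
      have e0 := I_mul_add_ne_zero ha y
      have e1 := I_mul_add_ne_zero one_re_pos y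
      have e2 := I_mul_add_ne_zero two_re_pos y
      field_simp
      ring
    have h := congrArg (fun x => ⟪x, r⟫_ℂ) hdecomp
    simp only [inner_add_left, inner_smul_left, (hE δ hδmem).1, (hE δ hδmem).2,
      hrθ _ (cauchyL2_mem_Hplus ha), mul_zero, add_zero] at h
    refine (mul_eq_zero.1 h).resolve_left ?_
    refine (map_ne_zero _).2 (mul_ne_zero (fun h => ?_) (fun h => ?_))
    · have := congrArg Complex.re h
      simp at this; linarith
    · have := congrArg Complex.re h
      simp at this; linarith
  have hk : ∀ (a : ℂ) (ha : 0 < a.re), ⟪cauchyL2 a ha, r⟫_ℂ = 0 := by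
    intro a ha
    by_cases ha1 : a = 1
    · subst ha1; exact hk1
    set u : ℝ → ℂ := fun y => conj (cauchyL2 1 one_re_pos y) * r y with hu_def
    have hu : Integrable u := integrable_conj_mul _ r
    have hc : 0 < (conj a).re := by simpa using ha
    have hψ : ∀ t ∈ Set.Icc 0 δ, ∫ y : ℝ, expChar (-t) y * u y = 0 := fun t ht => by
      rw [← (hE t ht).1, inner_mulL_expChar]
    have hsplit : ∫ x in Set.Ioi (0 : ℝ), Complex.exp (-conj a * x) *
          ∫ y : ℝ, expChar (-x) y * u y =
        ∫ x in Set.Ioi δ, Complex.exp (-conj a * x) * ∫ y : ℝ, expChar (-x) y * u y := by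
      refine setIntegral_eq_of_subset_of_forall_sdiff_eq_zero measurableSet_Ioi
        (Set.Ioi_subset_Ioi hδ.le) fun x hx => ?_
      rw [hψ x ⟨le_of_lt hx.1, not_lt.1 hx.2⟩, mul_zero]
    have hker : ∀ t : ℝ, ∫ y : ℝ, Complex.exp (-conj a * t) *
        (expChar (-t) y * ((conj a - I * y)⁻¹ * u y)) = Complex.exp (-conj a * t) *
          ⟪mulL (expChar t * cauchyKernel a ha) (cauchyL2 1 one_re_pos), r⟫_ℂ := fun t => by
      rw [integral_const_mul, inner_eq_integral]
      congr 1
      refine integral_congr_ae ?_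
      filter_upwards [coeFn_mulL (expChar t * cauchyKernel a ha) (cauchyL2 1 one_re_pos)] with y hy
      rw [hy, BoundedContinuousFunction.mul_apply, map_mul, map_mul, conj_expChar,
        cauchyKernel_apply, map_inv₀, map_add, map_mul, Complex.conj_I, Complex.conj_ofReal,
        neg_mul, neg_add_eq_sub, hu_def]
      ring
    rw [integral_Ioi_exp_mul_integral hu hc, integral_Ioi_exp_mul_integral hu hc, hker, hker,
      mulL_mul_cauchyKernel_cauchyL2 _ one_re_pos ha (Ne.symm ha1),
      mulL_mul_cauchyKernel_cauchyL2 _ one_re_pos ha (Ne.symm ha1), inner_smul_left, inner_smul_left,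
      inner_sub_left, inner_sub_left, hδk, hδk, hexp0, mulL_one, mulL_one, hk1] at hsplit
    simp only [Complex.ofReal_zero, mul_zero, Complex.exp_zero, one_mul, sub_zero] at hsplit
    exact (mul_eq_zero.1 hsplit).resolve_left
      ((map_ne_zero _).2 (inv_ne_zero (sub_ne_zero.2 (Ne.symm ha1))))
  have hle : Hplus ≤ (ℂ ∙ r)ᗮ := Hplus_le (Submodule.isClosed_orthogonal _) fun a ha =>
    Submodule.mem_orthogonal_singleton_iff_inner_left.2 (hk a ha)
  exact inner_self_eq_zero.1 (Submodule.mem_orthogonal_singleton_iff_inner_left.1 (hle hrH))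

theorem genSpan_eq_modelSpace {δ : ℝ} (hδ : 0 < δ) : genSpan δ = modelSpace δ := by
  have hle := genSpan_le_modelSpace δ
  refine le_antisymm hle fun f hf => ?_
  have : CompleteSpace (genSpan δ) :=
    (Submodule.isClosed_topologicalClosure _).completeSpace_coe
  obtain ⟨n, hn, r, hr, rfl⟩ := (genSpan δ).exists_add_mem_mem_orthogonal f
  have hrK : r ∈ modelSpace δ := by
    simpa using (modelSpace δ).sub_mem hf (hle hn)
  rw [eq_zero_of_mem_modelSpace hδ hrK fun t ht =>
    (Submodule.mem_orthogonal _ _).1 hr _ (mulL_genL2_mem_genSpan ht), add_zero]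
  exact hn

/-- `N(1/((1+s)(s+2))) = K_θ` with
`θ(s) = ((1-s)/(1+s))((2-s)/(2+s)) e^{-δ s}`. -/
theorem cyclic_stmt19 (δ : ℝ) (hδ : 0 < δ) :
    NspanP δ (fun y : ℝ => ((1 + Complex.I * y) * (Complex.I * y + 2))⁻¹)
      = KmodP (fun y : ℝ => (1 - Complex.I * y) / (1 + Complex.I * y) *
          ((2 - Complex.I * y) / (2 + Complex.I * y)) *
          Complex.exp (-(δ : ℂ) * (Complex.I * y))) := by
  rw [NspanP_eq_genSpan, KmodP_eq_modelSpace, genSpan_eq_modelSpace hδ]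

end
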